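/- Let S be a finite set, A₀ ⊆ S, T ⊆ S \ A₀, and k a natural number with |A₀| ≤ k < |S|. Let 𝒫 be the (nonempty) collection of subsets B of S with A₀ ⊆ B and |B| = k, let N = |𝒫|, let M = |S| − |A₀| and a = |T|, and let β₀, β₁ be real numbers. Then (1/N) · ∑_{B ∈ 𝒫} (1/(|S| − k)) · ∑_{j ∈ S \ B} (if j ∈ T then β₀ else β₁) = (a/M)·β₀ + ((M − a)/M)·β₁. -/

import Mathlib

theorem aux_le {α : Type*} [DecidableEq α]
    (S A₀ : Finset α) (k : ℕ) (x y : α) (hx : x ∈ S \ A₀) (hy : y ∈ S \ A₀) :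
    (((Finset.powersetCard k S).filter (fun B => A₀ ⊆ B)).filter (fun B => x ∉ B)).card ≤
    (((Finset.powersetCard k S).filter (fun B => A₀ ⊆ B)).filter (fun B => y ∉ B)).card := by
  rw [Finset.mem_sdiff] at hx hy
  refine Finset.card_le_card_of_injOn (fun B => B.map (Equiv.swap x y).toEmbedding) ?_ ?_
  · intro B hB
    simp only [Finset.coe_filter, Finset.mem_filter, Finset.mem_powersetCard,
      Set.mem_setOf_eq, Finset.card_map] at hB ⊢
    obtain ⟨⟨⟨h1, h2⟩, h3⟩, h4⟩ := hB
    refine ⟨⟨⟨?_, h2⟩, ?_⟩, ?_⟩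
    · intro z hz
      rw [Finset.mem_map_equiv, Equiv.symm_swap] at hz
      have h5 := h1 hz
      by_cases e1 : z = x
      · rw [e1]; exact hx.1
      by_cases e2 : z = y
      · rw [e2]; exact hy.1
      rwa [Equiv.swap_apply_of_ne_of_ne e1 e2] at h5
    · intro z hz
      rw [Finset.mem_map_equiv, Equiv.symm_swap]
      have e1 : z ≠ x := fun e => hx.2 (e ▸ hz)
      have e2 : z ≠ y := fun e => hy.2 (e ▸ hz)
      rw [Equiv.swap_apply_of_ne_of_ne e1 e2]
      exact h3 hz
    · rw [Finset.mem_map_equiv, Equiv.symm_swap, Equiv.swap_apply_right]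
      exact h4
  · intro B _ C _ h
    exact Finset.map_injective _ h

/-- The expected utility of agent `i`: choosing the faulty set `B` uniformly among
size-`k` subsets of `S` containing `A₀`, then the dictator `j` uniformly from `S \ B`,
with utility `β₀` if `j ∈ T` and `β₁` otherwise, averages to
`(a/M)·β₀ + ((M − a)/M)·β₁`, where `M = |S| − |A₀|` and `a = |T|`. -/
theorem expected_utility_random_dictatorship {α : Type*} [DecidableEq α]
    (S A₀ T : Finset α) (hA : A₀ ⊆ S) (hT : T ⊆ S \ A₀)
    (k : ℕ) (hk₁ : A₀.card ≤ k) (hk₂ : k < S.card) (β₀ β₁ : ℝ) :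
    (1 / (((Finset.powersetCard k S).filter (fun B => A₀ ⊆ B)).card : ℝ)) *
      ∑ B ∈ (Finset.powersetCard k S).filter (fun B => A₀ ⊆ B),
        (1 / ((S.card : ℝ) - (k : ℝ))) *
          ∑ j ∈ S \ B, (if j ∈ T then β₀ else β₁) =
    ((T.card : ℝ) / ((S.card : ℝ) - (A₀.card : ℝ))) * β₀ +
      ((((S.card : ℝ) - (A₀.card : ℝ)) - (T.card : ℝ)) /
        ((S.card : ℝ) - (A₀.card : ℝ))) * β₁ := by
  set P := (Finset.powersetCard k S).filter (fun B => A₀ ⊆ B) with hP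
  have hPne : P.Nonempty := by
    obtain ⟨B, h1, h2, h3⟩ := Finset.exists_subsuperset_card_eq hA hk₁ hk₂.le
    exact ⟨B, by simp [hP, Finset.mem_powersetCard, h1, h2, h3]⟩
  have hMlt : A₀.card < S.card := lt_of_le_of_lt hk₁ hk₂
  obtain ⟨x, hx⟩ : (S \ A₀).Nonempty := by
    rw [← Finset.card_pos, Finset.card_sdiff_of_subset hA]; omega
  have hM : ((S \ A₀).card : ℝ) = (S.card : ℝ) - (A₀.card : ℝ) := by
    rw [Finset.card_sdiff_of_subset hA, Nat.cast_sub hMlt.le]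
  set c : ℝ := ((P.filter (fun B => x ∉ B)).card : ℝ) with hc
  have key : ∀ f : α → ℝ, ∑ B ∈ P, ∑ j ∈ S \ B, f j = c * ∑ j ∈ S \ A₀, f j := by
    intro f
    have h1 : ∀ B ∈ P, ∑ j ∈ S \ B, f j = ∑ j ∈ S \ A₀, if j ∉ B then f j else 0 := by
      intro B hB
      have hAB : A₀ ⊆ B := (Finset.mem_filter.1 hB).2
      rw [← Finset.sum_filter]
      congr 1
      ext z
      simp only [Finset.mem_sdiff, Finset.mem_filter]
      constructor
      · rintro ⟨h, h'⟩
        exact ⟨⟨h, fun q => h' (hAB q)⟩, h'⟩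
      · rintro ⟨⟨h, _⟩, h'⟩
        exact ⟨h, h'⟩
    rw [Finset.sum_congr rfl h1, Finset.sum_comm, Finset.mul_sum]
    refine Finset.sum_congr rfl fun j hj => ?_
    rw [← Finset.sum_filter, Finset.sum_const, nsmul_eq_mul, hc,
      le_antisymm (aux_le S A₀ k j x hj hx) (aux_le S A₀ k x j hx hj)]
  have hone : (P.card : ℝ) * ((S.card : ℝ) - k) = c * ((S.card : ℝ) - (A₀.card : ℝ)) := by
    have h := key (fun _ => 1)
    simp only [Finset.sum_const, nsmul_eq_mul, mul_one] at h
    rw [hM] at h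
    rw [← h, ← nsmul_eq_mul, ← Finset.sum_const]
    refine Finset.sum_congr rfl fun B hB => ?_
    obtain ⟨hBS, hBk⟩ := Finset.mem_powersetCard.1 (Finset.mem_filter.1 hB).1
    rw [Finset.card_sdiff_of_subset hBS, hBk, Nat.cast_sub hk₂.le]
  have hsum : ∑ j ∈ S \ A₀, (if j ∈ T then β₀ else β₁) =
      T.card * β₀ + (((S.card : ℝ) - A₀.card) - T.card) * β₁ := by
    rw [← Finset.sum_sdiff hT, Finset.sum_congr rfl (g := fun _ => β₁)
      (fun j hj => if_neg (Finset.mem_sdiff.1 hj).2),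
      Finset.sum_congr (s₁ := T) rfl (g := fun _ => β₀) (fun j hj => if_pos hj)]
    simp only [Finset.sum_const, nsmul_eq_mul]
    rw [Finset.card_sdiff_of_subset hT, Nat.cast_sub (Finset.card_le_card hT), hM]
    ring
  rw [← Finset.mul_sum, key, hsum]
  have hN0 : (P.card : ℝ) ≠ 0 := by exact_mod_cast hPne.card_pos.ne'
  have hk0 : (S.card : ℝ) - k ≠ 0 := sub_ne_zero.2 (by exact_mod_cast hk₂.ne')
  have hM0 : (S.card : ℝ) - A₀.card ≠ 0 := sub_ne_zero.2 (by exact_mod_cast hMlt.ne')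
  generalize (S.card : ℝ) - A₀.card = M at *
  generalize (S.card : ℝ) - k = K at *
  field_simp
  linear_combination (-(T.card * β₀ + (M - T.card) * β₁)) * hone
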